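/- Let k be a field of characteristic not 2 in which -1 is not a square, and let n ≥ 1. If A ∈ Sp(2n,k) satisfies A² = -I, then there exists an invertible 2n×2n matrix U over k such that A = U·J·U⁻¹ and UᵀJU = [[0, U₁],[-U₁, 0]] for some diagonal n×n matrix U₁. -/

import Mathlib

open Matrix

/-- The standard symplectic form matrix `J = [[0, Iₙ], [-Iₙ, 0]]`. -/
def SpJ (n : ℕ) (R : Type*) [CommRing R] : Matrix (Fin n ⊕ Fin n) (Fin n ⊕ Fin n) R :=
  Matrix.fromBlocks 0 1 (-1) 0

/-- `M` belongs to the symplectic group `Sp(2n,R)`, i.e. `Mᵀ J M = J`. -/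
def IsSymp {n : ℕ} {R : Type*} [CommRing R]
    (M : Matrix (Fin n ⊕ Fin n) (Fin n ⊕ Fin n) R) : Prop :=
  Mᵀ * SpJ n R * M = SpJ n R

/-- In the setting of a skew-adjoint isometry `T` with `T² = -1`, an orthogonal family
of anisotropic vectors that spans, together with its image, a proper subspace can be extended
by one anisotropic vector. -/
theorem exists_anisotropic_orthogonal {k V : Type*} [Field k] [AddCommGroup V] [Module k V]
    (hchar : (2 : k) ≠ 0) (B : LinearMap.BilinForm k V) (hB : ∀ x y, B x y = B y x)
    (hnd : ∀ x, (∀ y, B x y = 0) → x = 0) (T : V →ₗ[k] V)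
    (hBT : ∀ x y, B (T x) (T y) = B x y) {m : ℕ} (hm : 2 * m < Module.finrank k V)
    (v : Fin m → V) (hv : ∀ i j, B (v i) (T (v j)) = 0) (hv' : ∀ i j, i ≠ j → B (v i) (v j) = 0)
    (hv0 : ∀ i, B (v i) (v i) ≠ 0) :
    ∃ w, (∀ i, B w (v i) = 0) ∧ (∀ i, B w (T (v i)) = 0) ∧ B w w ≠ 0 := by
  by_contra! hcon
  have hpol : ∀ x y, (∀ i, B x (v i) = 0) → (∀ i, B x (T (v i)) = 0) → (∀ i, B y (v i) = 0) →
      (∀ i, B y (T (v i)) = 0) → B x y = 0 := by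
    intro x y hx hx' hy hy'
    have h := hcon (x + y) (fun i => by simp [hx, hy]) (fun i => by simp [hx', hy'])
    have h1 := hcon x hx hx'
    have h3 := hcon y hy hy'
    simp only [map_add, LinearMap.add_apply, h1, h3, hB y x] at h
    have : 2 * B x y = 0 := by linear_combination h
    exact (mul_eq_zero.mp this).resolve_left hchar
  let p : V → V := fun x => ∑ i, ((B x (v i) / B (v i) (v i)) • v i +
    (B x (T (v i)) / B (v i) (v i)) • T (v i))
  have hp : ∀ x j, B (x - p x) (v j) = 0 := by
    intro x j
    simp only [p, map_sub, map_sum, map_add, map_smul, LinearMap.sub_apply, LinearMap.sum_apply,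
      LinearMap.add_apply, LinearMap.smul_apply, smul_eq_mul, hB (T (v _)), hv, mul_zero, add_zero]
    rw [Finset.sum_eq_single j (fun i _ hij => by rw [hv' i j hij, mul_zero]) (by simp),
      div_mul_cancel₀ _ (hv0 j), sub_self]
  have hp' : ∀ x j, B (x - p x) (T (v j)) = 0 := by
    intro x j
    simp only [p, map_sub, map_sum, map_add, map_smul, LinearMap.sub_apply, LinearMap.sum_apply,
      LinearMap.add_apply, LinearMap.smul_apply, smul_eq_mul, hBT, hv, mul_zero, zero_add]
    rw [Finset.sum_eq_single j (fun i _ hij => by rw [hv' i j hij, mul_zero]) (by simp),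
      div_mul_cancel₀ _ (hv0 j), sub_self]
  have hpx : ∀ x, x = p x := by
    intro x
    refine sub_eq_zero.mp (hnd _ fun y => ?_)
    have hy : B (x - p x) (p y) = 0 := by
      change B (x - p x) (∑ i, _) = 0
      simp only [map_sum, map_add, map_smul, hp, hp', smul_zero, add_zero,
        Finset.sum_const_zero]
    rw [← sub_add_cancel y (p y), map_add, hy, add_zero]
    exact hpol _ _ (hp x) (hp' x) (hp y) (hp' y)
  have hspan : Submodule.span k (Set.range (Sum.elim v (fun i => T (v i)))) = ⊤ := by
    refine eq_top_iff.mpr fun x _ => ?_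
    rw [hpx x]
    exact Submodule.sum_mem _ fun i _ => Submodule.add_mem _
      (Submodule.smul_mem _ _ (Submodule.subset_span ⟨Sum.inl i, rfl⟩))
      (Submodule.smul_mem _ _ (Submodule.subset_span ⟨Sum.inr i, rfl⟩))
  have hle := finrank_range_le_card (R := k) (Sum.elim v (fun i => T (v i)))
  rw [Set.finrank, hspan, finrank_top, Fintype.card_sum, Fintype.card_fin] at hle
  lia

/-- A nondegenerate symmetric bilinear form with an isometry `T` satisfying `T² = -1` admits
an orthogonal family of anisotropic vectors, also orthogonal to its image under `T`, of any size
up to half the dimension. -/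
theorem exists_orthogonal_family {k V : Type*} [Field k] [AddCommGroup V] [Module k V]
    (hchar : (2 : k) ≠ 0) (B : LinearMap.BilinForm k V) (hB : ∀ x y, B x y = B y x)
    (hnd : ∀ x, (∀ y, B x y = 0) → x = 0) (T : V →ₗ[k] V) (hT : ∀ x, T (T x) = -x)
    (hBT : ∀ x y, B (T x) (T y) = B x y) (m : ℕ) (hm : 2 * m ≤ Module.finrank k V) :
    ∃ v : Fin m → V, (∀ i j, B (v i) (T (v j)) = 0) ∧ (∀ i j, i ≠ j → B (v i) (v j) = 0) ∧
      ∀ i, B (v i) (v i) ≠ 0 := by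
  have hskew : ∀ x y, B x (T y) = -B y (T x) := by
    intro x y
    rw [← hBT x (T y), hT, map_neg, hB]
  induction m with
  | zero => exact ⟨Fin.elim0, fun i => i.elim0, fun i => i.elim0, fun i => i.elim0⟩
  | succ m ih =>
    obtain ⟨v, hv, hv', hv0⟩ := ih (by lia)
    obtain ⟨w, hw, hw', hw0⟩ :=
      exists_anisotropic_orthogonal hchar B hB hnd T hBT (by lia) v hv hv' hv0
    have hww : B w (T w) = 0 := by
      have : 2 * B w (T w) = 0 := by linear_combination hskew w w
      exact (mul_eq_zero.mp this).resolve_left hchar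
    refine ⟨Fin.cons w v, fun i j => ?_, fun i j hij => ?_, fun i => ?_⟩
    · cases i using Fin.cases <;> cases j using Fin.cases
      · simpa using hww
      · simpa using hw' _
      · simpa [hskew _ w] using hw' _
      · simpa using hv _ _
    · cases i using Fin.cases <;> cases j using Fin.cases
      · exact absurd rfl hij
      · simpa using hw _
      · simpa [hB _ w] using hw _
      · simpa using hv' _ _ (fun h => hij (by rw [h]))
    · cases i using Fin.cases
      · simpa using hw0
      · simpa using hv0 _

theorem SpJ_mul_self (n : ℕ) (R : Type*) [CommRing R] : SpJ n R * SpJ n R = -1 := by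
  rw [SpJ, fromBlocks_multiply, ← fromBlocks_one, fromBlocks_neg]
  simp

theorem SpJ_transpose (n : ℕ) (R : Type*) [CommRing R] : (SpJ n R)ᵀ = -SpJ n R := by
  rw [SpJ, fromBlocks_transpose, fromBlocks_neg]
  simp

theorem isUnit_fromBlocks_diagonal {k : Type*} [Field k] {n : ℕ} (d : Fin n → k)
    (hd : ∀ i, d i ≠ 0) :
    IsUnit (fromBlocks 0 (diagonal d) (-(diagonal d)) 0) := by
  refine IsUnit.of_mul_eq_one
    (fromBlocks 0 (-(diagonal fun i => (d i)⁻¹)) (diagonal fun i => (d i)⁻¹) 0) ?_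
  rw [fromBlocks_multiply, ← fromBlocks_one]
  simp [diagonal_mul_diagonal, hd]

/-- If `-1` is not a square in `k` and `A ∈ Sp(2n,k)` satisfies `A² = -I`, then `A = UJU⁻¹`
for some invertible `U` with `UᵀJU = [[0,U₁],[-U₁,0]]`, `U₁` diagonal. -/
theorem stmt15 {k : Type*} [Field k] (hchar : (2 : k) ≠ 0)
    (hsq : ∀ x : k, x ^ 2 ≠ -1) {n : ℕ} (hn : 1 ≤ n)
    (A : Matrix (Fin n ⊕ Fin n) (Fin n ⊕ Fin n) k) (hA : IsSymp A)
    (h2 : A * A = -1) :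
    ∃ U : Matrix (Fin n ⊕ Fin n) (Fin n ⊕ Fin n) k, IsUnit U ∧
      A = U * SpJ n k * U⁻¹ ∧
      ∃ d : Fin n → k,
        Uᵀ * SpJ n k * U =
          Matrix.fromBlocks 0 (Matrix.diagonal d) (-(Matrix.diagonal d)) 0 := by
  have hAJ : Aᵀ * SpJ n k = -(SpJ n k * A) := by
    have h : Aᵀ * SpJ n k * (A * A) = SpJ n k * A := by rw [← Matrix.mul_assoc, hA]
    rw [h2, Matrix.mul_neg, Matrix.mul_one] at h
    rw [← h, neg_neg]
  have hS : (SpJ n k * A)ᵀ = SpJ n k * A := by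
    rw [transpose_mul, SpJ_transpose, Matrix.mul_neg, hAJ, neg_neg]
  have hSS : (A * SpJ n k) * (SpJ n k * A) = 1 := by
    rw [Matrix.mul_assoc, ← Matrix.mul_assoc (SpJ n k), SpJ_mul_self]
    simp [h2]
  have hSA : Aᵀ * (SpJ n k * A) * A = SpJ n k * A := by
    rw [← Matrix.mul_assoc, hA]
  let B : LinearMap.BilinForm k (Fin n ⊕ Fin n → k) := Matrix.toBilin' (SpJ n k * A)
  have hBdef : ∀ x y, B x y = x ⬝ᵥ (SpJ n k * A) *ᵥ y := fun x y =>
    Matrix.toBilin'_apply' _ x y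
  have hB : ∀ x y, B x y = B y x := by
    intro x y
    rw [hBdef, hBdef, dotProduct_mulVec, ← mulVec_transpose, hS, dotProduct_comm]
  have hnd : ∀ x, (∀ y, B x y = 0) → x = 0 := by
    intro x hx
    have h : (SpJ n k * A) *ᵥ x = 0 := by
      refine dotProduct_eq_zero _ fun y => ?_
      rw [dotProduct_comm, ← hBdef, hB, hx]
    have h' := congrArg ((A * SpJ n k) *ᵥ ·) h
    simpa only [mulVec_mulVec, hSS, one_mulVec, mulVec_zero] using h'
  have hBT : ∀ x y, B (A.mulVecLin x) (A.mulVecLin y) = B x y := by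
    intro x y
    rw [hBdef, hBdef, mulVecLin_apply, mulVecLin_apply, ← vecMul_transpose, ← dotProduct_mulVec,
      mulVec_mulVec, mulVec_mulVec, hSA]
  obtain ⟨v, hv, hv', hv0⟩ := exists_orthogonal_family hchar B hB hnd A.mulVecLin
    (fun x => by simp [mulVec_mulVec, h2, neg_mulVec]) hBT n (by simp [two_mul])
  let P : Matrix (Fin n ⊕ Fin n) (Fin n) k := (Matrix.of v)ᵀ
  have hentry : ∀ (M : Matrix (Fin n ⊕ Fin n) (Fin n ⊕ Fin n) k) i j,
      (Pᵀ * M * P) i j = v i ⬝ᵥ M *ᵥ v j := by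
    intro M i j
    rw [Matrix.mul_assoc]
    rfl
  have hPP : Pᵀ * SpJ n k * P = 0 := by
    ext i j
    have h := hv i j
    rw [hBdef, mulVecLin_apply, mulVec_mulVec, Matrix.mul_assoc, h2] at h
    rw [hentry]
    simpa [neg_mulVec] using h
  have hPAP : Pᵀ * (SpJ n k * A) * P = diagonal fun i => B (v i) (v i) := by
    ext i j
    rw [hentry, ← hBdef]
    by_cases hij : i = j
    · subst hij
      rw [diagonal_apply_eq]
    · rw [diagonal_apply_ne _ hij, hv' i j hij]
  have hUJU : (fromCols P (-(A * P)))ᵀ * SpJ n k * fromCols P (-(A * P)) =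
      fromBlocks 0 (diagonal fun i => -B (v i) (v i))
        (-(diagonal fun i => -B (v i) (v i))) 0 := by
    have hneg : (diagonal fun i => -B (v i) (v i)) = -(Pᵀ * (SpJ n k * A) * P) := by
      rw [hPAP, diagonal_neg]
    rw [transpose_fromCols, fromRows_mul, fromRows_mul_fromCols, hneg]
    congr 1
    · simp only [Matrix.mul_neg, Matrix.mul_assoc]
    · rw [transpose_neg, transpose_mul, Matrix.neg_mul, Matrix.neg_mul, Matrix.mul_assoc Pᵀ, hAJ]
      simp
    · rw [transpose_neg, transpose_mul, Matrix.neg_mul, Matrix.neg_mul, Matrix.mul_neg, neg_neg,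
        ← Matrix.mul_assoc, Matrix.mul_assoc Pᵀ, Matrix.mul_assoc Pᵀ, hA, hPP]
  have hU : IsUnit (fromCols P (-(A * P))) := by
    have h := isUnit_fromBlocks_diagonal (fun i => -B (v i) (v i)) fun i => neg_ne_zero.mpr (hv0 i)
    rw [← hUJU, isUnit_iff_isUnit_det, det_mul] at h
    exact (isUnit_iff_isUnit_det _).mpr (isUnit_of_mul_isUnit_right h)
  refine ⟨fromCols P (-(A * P)), hU, ?_, _, hUJU⟩
  have hcomm : fromCols P (-(A * P)) * SpJ n k = A * fromCols P (-(A * P)) := by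
    rw [SpJ, fromCols_mul_fromBlocks, mul_fromCols, Matrix.mul_neg A, ← Matrix.mul_assoc A A, h2]
    simp
  rw [hcomm, Matrix.mul_assoc, mul_nonsing_inv _ ((isUnit_iff_isUnit_det _).mp hU),
    Matrix.mul_one]
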